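/- Let (Δ,Φ) be a Lorentzian based root system of level 2, and fix a time-like vector t in the fundamental chamber C*. The associated Boyd–Maxwell ball packing {ball(ω) : ω ∈ Ω, B(ω,ω) > 0} is maximal: if v ∈ V is space-like and the interior of ball(v) is disjoint from the interior of ball(ω) for every space-like ω ∈ Ω, then ball(v) = ball(ω) for some space-like ω ∈ Ω. -/

import Mathlib

open scoped BigOperators

namespace BoydMaxwell

variable {V : Type*} [AddCommGroup V] [Module ℝ V]

/-- `(V, B)` is a Lorentz space: `B` is non-degenerate with exactly one negative
eigenvalue, i.e. there is a time-like vector but every subspace on which `B` is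
negative definite has dimension at most `1`. -/
def IsLorentz (B : LinearMap.BilinForm ℝ V) : Prop :=
  B.Nondegenerate ∧ (∃ v : V, B v v < 0) ∧
    ∀ W : Submodule ℝ V, (∀ v ∈ W, v ≠ 0 → B v v < 0) → Module.finrank ℝ W ≤ 1

/-- A root basis in the quadratic space `(V, B)`. -/
structure IsRootBasis (B : LinearMap.BilinForm ℝ V) (Δ : Finset V) : Prop where
  unit : ∀ α ∈ Δ, B α α = 1
  offdiag : ∀ α ∈ Δ, ∀ β ∈ Δ, α ≠ β →
    B α β ≤ -1 ∨ ∃ k : ℕ, 2 ≤ k ∧ B α β = -Real.cos (Real.pi / k)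
  posIndep : ∀ c : V → ℝ, (∀ α ∈ Δ, 0 ≤ c α) →
    (∑ α ∈ Δ, c α • α) = 0 → ∀ α ∈ Δ, c α = 0
  spans : Submodule.span ℝ (Δ : Set V) = ⊤

/-- The reflection `s_α : x ↦ x - 2 B(α,x) α`. -/
def reflection (B : LinearMap.BilinForm ℝ V) (α : V) : V →ₗ[ℝ] V :=
  LinearMap.id - (B α).smulRight ((2 : ℝ) • α)

/-- The Weyl group `W`: the subgroup of linear automorphisms generated by the
reflections in the simple roots. -/
def weylGroup (B : LinearMap.BilinForm ℝ V) (Δ : Finset V) : Subgroup (V ≃ₗ[ℝ] V) :=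
  Subgroup.closure { g : V ≃ₗ[ℝ] V | ∃ α ∈ Δ, (g : V →ₗ[ℝ] V) = reflection B α }

/-- The set of roots `Φ = W(Δ)`. -/
def roots (B : LinearMap.BilinForm ℝ V) (Δ : Finset V) : Set V :=
  { x | ∃ w ∈ weylGroup B Δ, ∃ α ∈ Δ, x = w α }

/-- The polyhedral cone of non-negative linear combinations of a finite set. -/
def cone (Δ : Finset V) : Set V :=
  { x | ∃ c : V → ℝ, (∀ α ∈ Δ, 0 ≤ c α) ∧ x = ∑ α ∈ Δ, c α • α }

/-- `F` is a face of the convex set `C`. -/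
def IsFace (C F : Set V) : Prop :=
  F ⊆ C ∧ Convex ℝ F ∧ ∀ x ∈ C, ∀ y ∈ C, ∀ t : ℝ, 0 < t → t < 1 →
    t • x + (1 - t) • y ∈ F → x ∈ F ∧ y ∈ F

/-- `I ⊆ Δ` is an `l`-facial subset: `Cone(I)` is a face of `Cone(Δ)` and
`Span(I)` has codimension `l` in `V`. -/
def IsFacial (Δ I : Finset V) (l : ℕ) : Prop :=
  I ⊆ Δ ∧ IsFace (cone Δ) (cone I) ∧
    Module.finrank ℝ (Submodule.span ℝ (I : Set V)) + l = Module.finrank ℝ V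

/-- `B` is positive semidefinite on the span of every `l`-facial subset. -/
def LevelLE (B : LinearMap.BilinForm ℝ V) (Δ : Finset V) (l : ℕ) : Prop :=
  ∀ I : Finset V, IsFacial Δ I l → ∀ x ∈ Submodule.span ℝ (I : Set V), 0 ≤ B x x

/-- The root system generated by `Δ` has level exactly `l`: `l` is the smallest
integer such that `B` is positive semidefinite on the span of every `l`-facial
subset of `Δ`. -/
def HasLevel (B : LinearMap.BilinForm ℝ V) (Δ : Finset V) (l : ℕ) : Prop :=
  LevelLE B Δ l ∧ ∀ m : ℕ, m < l → ¬ LevelLE B Δ m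

/-- `ω` is the weight associated to the `1`-facial subset `I`. -/
def IsWeight (B : LinearMap.BilinForm ℝ V) (Δ I : Finset V) (ω : V) : Prop :=
  IsFacial Δ I 1 ∧ (∀ α ∈ I, B α ω = 0) ∧
    (∀ α ∈ Δ, α ∉ I → 0 < B α ω) ∧
    (∀ α ∈ Δ, α ∉ I → 1 ≤ B α ω) ∧ (∃ α ∈ Δ, α ∉ I ∧ B α ω = 1)

/-- The set `Δ*` of weights. -/
def weights (B : LinearMap.BilinForm ℝ V) (Δ : Finset V) : Set V :=
  { ω | ∃ I : Finset V, IsWeight B Δ I ω }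

/-- The orbit `Ω = W(Δ*)`. -/
def Omega (B : LinearMap.BilinForm ℝ V) (Δ : Finset V) : Set V :=
  { x | ∃ w ∈ weylGroup B Δ, ∃ ω ∈ weights B Δ, x = w ω }

/-- Two vectors are disjoint: `B(x,y) ≤ 0` and `B` is not positive definite on
`Span{x,y}`. -/
def DisjointVec (B : LinearMap.BilinForm ℝ V) (x y : V) : Prop :=
  B x y ≤ 0 ∧ ¬ ∀ z ∈ Submodule.span ℝ ({x, y} : Set V), z ≠ 0 → 0 < B z z

/-- The fundamental chamber `C* = {x | B(x, α) ≥ 0 for all α ∈ Δ}`. -/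
def chamber (B : LinearMap.BilinForm ℝ V) (Δ : Finset V) : Set V :=
  { x | ∀ α ∈ Δ, 0 ≤ B x α }

/-- The Tits cone `T = ⋃_{w ∈ W} w(C*)`. -/
def titsCone (B : LinearMap.BilinForm ℝ V) (Δ : Finset V) : Set V :=
  { x | ∃ w ∈ weylGroup B Δ, ∃ y ∈ chamber B Δ, x = w y }

/-- The convex cone generated by an arbitrary set. -/
def coneOf (X : Set V) : Set V :=
  { x | ∃ (s : Finset V) (c : V → ℝ), (↑s ⊆ X) ∧ (∀ v ∈ s, 0 ≤ c v) ∧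
      x = ∑ v ∈ s, c v • v }


/-- The closed ball associated to a space-like vector `v` (given a fixed
time-like direction of past `t`), described by its cone of light-like vector
representatives: `ball(v) = {[x] : x ≠ 0, B(x,x) = 0, B(v,x)·B(t,x) ≤ 0}`. -/
def ballVec {V : Type*} [AddCommGroup V] [Module ℝ V]
    (B : LinearMap.BilinForm ℝ V) (t v : V) : Set V :=
  { x | x ≠ 0 ∧ B x x = 0 ∧ B v x * B t x ≤ 0 }

/-- The interior of the ball of `v` relative to the projective light cone,
described by its cone of vector representatives. -/
def ballIntVec {V : Type*} [AddCommGroup V] [Module ℝ V]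
    (B : LinearMap.BilinForm ℝ V) (t v : V) : Set V :=
  { x | x ≠ 0 ∧ B x x = 0 ∧ B v x * B t x < 0 }

section Helpers

variable {B : LinearMap.BilinForm ℝ V}

/-- Bilinear expansion of `B (a • x + b • y) (c • z + d • u)`. -/
lemma expand (x y z u : V) (a b c d : ℝ) :
    B (a • x + b • y) (c • z + d • u) =
      a * c * B x z + a * d * B x u + b * c * B y z + b * d * B y u := by
  simp only [map_add, map_smul, LinearMap.add_apply, LinearMap.smul_apply, smul_eq_mul]
  ring

lemma expand_right (x z u : V) (c d : ℝ) :
    B x (c • z + d • u) = c * B x z + d * B x u := by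
  simp only [map_add, map_smul, smul_eq_mul]

/-- Small perturbations of a negative number stay negative. -/
lemma exists_small (T b c : ℝ) (hT : T < 0) :
    ∃ ε : ℝ, 0 < ε ∧ T + ε * b + ε ^ 2 * c < 0 := by
  have hb := abs_nonneg b
  have hc := abs_nonneg c
  set K := |b| + |c| with hK
  have hK0 : 0 ≤ K := by positivity
  have hd : 0 < K - T := by linarith
  refine ⟨-T / (K - T), div_pos (by linarith) hd, ?_⟩
  set ε := -T / (K - T) with hε
  have h1 : ε * (K - T) = -T := by rw [hε]; field_simp
  have h0 : 0 < ε := div_pos (by linarith) hd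
  have h2 : ε ≤ 1 := by rw [hε, div_le_one hd]; linarith
  have h3 : ε * b ≤ ε * |b| := mul_le_mul_of_nonneg_left (le_abs_self b) h0.le
  have h4 : ε ^ 2 * c ≤ ε * |c| := by
    calc ε ^ 2 * c ≤ ε ^ 2 * |c| := mul_le_mul_of_nonneg_left (le_abs_self c) (by positivity)
      _ ≤ ε * |c| := mul_le_mul_of_nonneg_right (by nlinarith) hc
  have h5 : ε * |b| + ε * |c| = ε * K := by rw [hK]; ring
  nlinarith [mul_pos h0 (neg_pos.2 hT)]

lemma perp_nonneg [FiniteDimensional ℝ V] (hsymm : ∀ x y : V, B x y = B y x) (hLor : IsLorentz B)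
    {t x : V} (ht : B t t < 0) (hx : B t x = 0) : 0 ≤ B x x := by
  by_contra hneg
  push Not at hneg
  have hxt : B x t = 0 := by rw [hsymm, hx]
  have hli : LinearIndependent ℝ ![t, x] := by
    rw [LinearIndependent.pair_iff]
    intro a b hab
    have h1 : B t (a • t + b • x) = 0 := by rw [hab, map_zero]
    have h2 : B x (a • t + b • x) = 0 := by rw [hab, map_zero]
    rw [expand_right, hx] at h1
    rw [expand_right, hxt] at h2
    constructor
    · by_contra ha
      simp [ha, ht.ne] at h1
    · by_contra ha
      simp [ha, hneg.ne] at h2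
  have hr := hLor.2.2 (Submodule.span ℝ (Set.range ![t, x])) (by
    intro v hv hv0
    rw [Matrix.range_cons, Matrix.range_cons, Matrix.range_empty, Set.union_empty,
      Set.singleton_union, Submodule.mem_span_pair] at hv
    obtain ⟨a, b, rfl⟩ := hv
    rw [expand, hx, hxt]
    by_cases ha : a = 0
    · have hb : b ≠ 0 := by
        rintro rfl
        simp [ha] at hv0
      have : 0 < b * b := mul_self_pos.2 hb
      subst ha
      nlinarith
    · have : 0 < a * a := mul_self_pos.2 ha
      nlinarith [mul_self_nonneg b])
  rw [finrank_span_eq_card hli] at hr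
  simp at hr

lemma perp_pos [FiniteDimensional ℝ V] (hsymm : ∀ x y : V, B x y = B y x) (hLor : IsLorentz B)
    {t x : V} (ht : B t t < 0) (hx : B t x = 0) (hx0 : x ≠ 0) : 0 < B x x := by
  rcases (perp_nonneg hsymm hLor ht hx).lt_or_eq with h | h
  · exact h
  exfalso
  apply hx0
  apply hLor.1.1 x
  intro z
  by_contra hz
  -- project `z` to the orthogonal complement of `t`
  set z' : V := (1 : ℝ) • z + (-(B t z / B t t)) • t with hz'
  have hxt : B x t = 0 := by rw [hsymm, hx]
  have htz : B t z' = 0 := by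
    rw [hz', expand_right]; field_simp [ht.ne]; ring
  have hxz : B x z' = B x z := by
    rw [hz', expand_right, hxt]; ring
  set b := B x z with hb
  set c := B z' z'
  have key : ∀ s : ℝ, 0 ≤ 2 * s * b + s ^ 2 * c := by
    intro s
    have := perp_nonneg hsymm hLor ht (x := (1 : ℝ) • x + s • z') (by
      rw [expand_right, hx, htz]; ring)
    rw [expand, hxz, hsymm z' x, hxz, ← h] at this
    nlinarith
  have hbne : b ≠ 0 := hz
  obtain ⟨ε, hε, h1⟩ := exists_small (-(2 * b ^ 2)) (b ^ 2 * c) 0 (by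
    have : 0 < b ^ 2 := by positivity
    linarith)
  have h2 := key (-(ε * b))
  nlinarith

/-- Two timelike vectors in the same cone see a causal vector with the same sign. -/
lemma same_sign [FiniteDimensional ℝ V] (hsymm : ∀ x y : V, B x y = B y x) (hLor : IsLorentz B)
    {t u x : V} (ht : B t t < 0) (hu : B u u < 0) (htu : B t u < 0) (hx0 : x ≠ 0)
    (hx : B x x ≤ 0) : 0 < B t x * B u x := by
  by_contra hcon
  push Not at hcon
  have h1 : B t x ≠ 0 := fun h => absurd (perp_pos hsymm hLor ht h hx0) (not_lt.2 hx)
  have h2 : B u x ≠ 0 := fun h => absurd (perp_pos hsymm hLor hu h hx0) (not_lt.2 hx)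
  have h3 : B t x * B u x < 0 := lt_of_le_of_ne hcon (mul_ne_zero h1 h2)
  set z : V := (B u x) • t + (-(B t x)) • u with hz
  have hzx : B z x = 0 := by
    rw [hsymm, hz, expand_right, hsymm x t, hsymm x u]; ring
  have hzz : B z z < 0 := by
    rw [hz, expand, hsymm u t]
    have : 0 < B u x * B u x := mul_self_pos.2 h2
    have : 0 < B t x * B t x := mul_self_pos.2 h1
    nlinarith [mul_pos_of_neg_of_neg h3 htu]
  exact absurd (perp_pos hsymm hLor hzz hzx hx0) (not_lt.2 hx)

/-- Two causal vectors in the future cone of `t` have non-positive product. -/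
lemma causal_pair [FiniteDimensional ℝ V] (hsymm : ∀ x y : V, B x y = B y x) (hLor : IsLorentz B)
    {t x y : V} (ht : B t t < 0) (hx : B x x ≤ 0) (hy : B y y ≤ 0)
    (htx : B t x < 0) (hty : B t y < 0) : B x y ≤ 0 := by
  by_contra hcon
  push Not at hcon
  have := perp_nonneg hsymm hLor ht (x := (B t y) • x + (-(B t x)) • y) (by
    rw [expand_right]; ring)
  rw [expand, hsymm y x] at this
  nlinarith [mul_pos (mul_pos_of_neg_of_neg htx hty) hcon, mul_self_nonneg (B t y),
    mul_self_nonneg (B t x), mul_nonneg (mul_self_nonneg (B t y)) (neg_nonneg.2 hx),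
    mul_nonneg (mul_self_nonneg (B t x)) (neg_nonneg.2 hy)]

/-- The interior of a ball of a space-like vector is nonempty. -/
lemma exists_light [FiniteDimensional ℝ V] (hsymm : ∀ x y : V, B x y = B y x)
    {t v : V} (ht : B t t < 0) (hv : 0 < B v v) :
    ∃ x : V, x ≠ 0 ∧ B x x = 0 ∧ B t x < 0 ∧ 0 < B v x := by
  set T := B t t with hT
  have hTne : T ≠ 0 := ht.ne
  set m := B t v with hm
  set p : V := (1 : ℝ) • v + (-(m / T)) • t with hp
  have htp : B t p = 0 := by
    rw [hp, expand_right, ← hm, ← hT]; field_simp <;> ring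
  have hvp : B v p = B v v - m ^ 2 / T := by
    rw [hp, expand_right, hsymm v t, ← hm]; field_simp <;> ring
  have hpp : B p p = B v v - m ^ 2 / T := by
    rw [hp, expand, hsymm v t, ← hm, ← hT]; field_simp <;> ring
  set P := B v v - m ^ 2 / T with hP
  have hmT : m ^ 2 / T ≤ 0 := div_nonpos_of_nonneg_of_nonpos (sq_nonneg _) ht.le
  have hPpos : 0 < P := by linarith
  set r := Real.sqrt (P / -T) with hr
  have hrpos : 0 < r := Real.sqrt_pos.2 (div_pos hPpos (by linarith))
  have hr2 : r ^ 2 * T = -P := by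
    rw [hr, Real.sq_sqrt (div_pos hPpos (by linarith)).le]
    field_simp
  have htx : B t (r • t + (1 : ℝ) • p) = r * T := by
    rw [expand_right, htp]; ring
  have hneg : B t (r • t + (1 : ℝ) • p) < 0 := by
    rw [htx]; exact mul_neg_of_pos_of_neg hrpos ht
  refine ⟨r • t + (1 : ℝ) • p, ?_, ?_, hneg, ?_⟩
  · intro h
    rw [h, map_zero] at hneg
    exact lt_irrefl _ hneg
  · rw [expand, htp, hsymm p t, htp, hpp, ← hT]
    nlinarith
  · rw [expand_right, hsymm v t, hvp, ← hm]
    have h1 : (r * m) ^ 2 < P ^ 2 := by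
      have e : (r * m) ^ 2 = P * (-(m ^ 2 / T)) := by
        have : r ^ 2 = -P / T := by rw [eq_div_iff hTne]; exact hr2
        rw [mul_pow, this]; field_simp
      rw [e]
      nlinarith
    have := abs_lt_of_sq_lt_sq h1 hPpos.le
    have := (abs_lt.1 this).1
    linarith

/-- The main quantitative bound: a unit-type vector with `B v u ≤ 0` for a timelike `u` has
`B v t` bounded above. -/
lemma bound_above [FiniteDimensional ℝ V] (hsymm : ∀ x y : V, B x y = B y x) (hLor : IsLorentz B)
    {t u : V} (ht : B t t < 0) (hu : B u u < 0) (htu : B t u < 0) (c : ℝ) :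
    ∃ M : ℝ, ∀ v : V, B v v = c → B v u ≤ 0 → 0 ≤ B v t → (B v t) ^ 2 ≤ M := by
  set U := B u u with hU
  have hUne : U ≠ 0 := hu.ne
  set m := B t u with hm
  refine ⟨c * (B t t - m ^ 2 / U), fun v hvc hvu hvt => ?_⟩
  set T := B t t with hT
  set f := B v t with hf
  set g := B v u with hg
  set p : V := (1 : ℝ) • v + (-(g / U)) • u with hp
  set q : V := (1 : ℝ) • t + (-(m / U)) • u with hq
  have hup : B u p = 0 := by
    rw [hp, expand_right, hsymm u v, ← hg, ← hU]; field_simp <;> ring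
  have huq : B u q = 0 := by
    rw [hq, expand_right, hsymm u t, ← hm, ← hU]; field_simp <;> ring
  have hpp : B p p = c - g ^ 2 / U := by
    rw [hp, expand, hsymm u v, ← hg, ← hU, hvc]; field_simp <;> ring
  have hqq : B q q = T - m ^ 2 / U := by
    rw [hq, expand, hsymm u t, ← hm, ← hU, ← hT]; field_simp <;> ring
  have hpq : B p q = f - g * m / U := by
    rw [hp, hq, expand, hsymm u t, ← hm, ← hU, ← hg, ← hf]; field_simp <;> ring
  have hcs : (B p q) ^ 2 ≤ B p p * B q q := by
    have key : ∀ s : ℝ, 0 ≤ B q q * (s * s) + (2 * B p q) * s + B p p := by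
      intro s
      have := perp_nonneg hsymm hLor hu (x := (1 : ℝ) • p + s • q) (by
        rw [expand_right, hup, huq]; ring)
      rw [expand, hsymm q p] at this
      nlinarith
    have := discrim_le_zero key
    rw [discrim] at this
    nlinarith
  rw [hpp, hqq, hpq] at hcs
  have hmU : 0 < m / U := div_pos_of_neg_of_neg htu hu
  set l := m / U with hl
  have e1 : m = l * U := by rw [hl]; field_simp
  have e2 : m ^ 2 / U = l ^ 2 * U := by rw [e1]; field_simp
  have e3 : g * m / U = g * l := by rw [e1]; field_simp
  rw [e2] at hcs ⊢
  rw [e3] at hcs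
  set k := g ^ 2 / U with hk
  have e4 : g ^ 2 = k * U := by rw [hk]; field_simp
  have hk0 : k ≤ 0 := div_nonpos_of_nonneg_of_nonpos (sq_nonneg _) hu.le
  have h6 : 0 ≤ f * -g * l := mul_nonneg (mul_nonneg hvt (by linarith)) hmU.le
  have h7 : 0 ≤ k * T := mul_nonneg_of_nonpos_of_nonpos hk0 ht.le
  have h8 : (f - g * l) ^ 2 = f ^ 2 + 2 * (f * -g * l) + k * U * l ^ 2 := by rw [← e4]; ring
  rw [h8] at hcs
  nlinarith

lemma refl_apply (α x : V) : reflection B α x = x - (2 * B α x) • α := by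
  simp only [reflection, LinearMap.sub_apply, LinearMap.id_apply, LinearMap.smulRight_apply,
    smul_smul]
  congr 2; ring

lemma refl_isom (hsymm : ∀ x y : V, B x y = B y x) {α : V} (hα : B α α = 1) (x y : V) :
    B (reflection B α x) (reflection B α y) = B x y := by
  simp only [refl_apply, map_sub, map_smul, LinearMap.sub_apply, LinearMap.smul_apply,
    smul_eq_mul, hα, hsymm x α]
  ring

lemma refl_refl {α : V} (hα : B α α = 1) (x : V) :
    reflection B α (reflection B α x) = x := by
  simp only [refl_apply, map_sub, map_smul, hα]
  module

lemma refl_adj (hsymm : ∀ x y : V, B x y = B y x) {α : V} (hα : B α α = 1) (x y : V) :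
    B (reflection B α x) y = B x (reflection B α y) := by
  rw [← refl_isom hsymm hα, refl_refl hα]

lemma Omega_refl {Δ : Finset V} (hΔ : IsRootBasis B Δ) {α ω : V} (hα : α ∈ Δ)
    (hω : ω ∈ Omega B Δ) : reflection B α ω ∈ Omega B Δ := by
  obtain ⟨w, hw, ω', hω', rfl⟩ := hω
  let s : V ≃ₗ[ℝ] V := LinearEquiv.ofInvolutive (reflection B α) (refl_refl (hΔ.unit α hα))
  refine ⟨s * w, Subgroup.mul_mem _ (Subgroup.subset_closure ⟨α, hα, ?_⟩) hw, ω', hω', rfl⟩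
  ext x
  rfl

lemma weights_sub_Omega {Δ : Finset V} {ω : V} (hω : ω ∈ weights B Δ) : ω ∈ Omega B Δ :=
  ⟨1, Subgroup.one_mem _, ω, hω, rfl⟩

lemma offdiag_nonpos {Δ : Finset V} (hΔ : IsRootBasis B Δ) {α β : V} (hα : α ∈ Δ) (hβ : β ∈ Δ)
    (h : α ≠ β) : B α β ≤ 0 := by
  rcases hΔ.offdiag α hα β hβ h with h1 | ⟨k, hk, h1⟩
  · linarith
  · rw [h1, neg_nonpos]
    have hk' : (2 : ℝ) ≤ k := by exact_mod_cast hk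
    apply Real.cos_nonneg_of_neg_pi_div_two_le_of_le
    · have : 0 ≤ Real.pi / k := by positivity
      linarith [Real.pi_pos]
    · exact div_le_div_of_nonneg_left Real.pi_pos.le (by norm_num) hk'

/-- The cone over `Δ` contains a timelike vector. -/
lemma exists_timelike_in_cone {Δ : Finset V} (hΔ : IsRootBasis B Δ) (hLor : IsLorentz B) :
    ∃ c : V → ℝ, (∀ α, 0 ≤ c α) ∧ B (∑ α ∈ Δ, c α • α) (∑ α ∈ Δ, c α • α) < 0 := by
  obtain ⟨x, hx⟩ := hLor.2.1
  have hmem : x ∈ Submodule.span ℝ (Δ : Set V) := by rw [hΔ.spans]; trivial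
  obtain ⟨c, -, hc⟩ := Submodule.mem_span_finset.1 hmem
  refine ⟨fun α => |c α|, fun α => abs_nonneg _, lt_of_le_of_lt ?_ hx⟩
  rw [← hc]
  simp only [map_sum, LinearMap.sum_apply, map_smul, LinearMap.smul_apply, smul_eq_mul,
    Finset.mul_sum]
  refine Finset.sum_le_sum fun α hα => Finset.sum_le_sum fun β hβ => ?_
  by_cases h : β = α
  · subst h
    rw [← mul_assoc, ← mul_assoc, abs_mul_abs_self]
  · have h1 := offdiag_nonpos hΔ hβ hα h
    rw [← mul_assoc, ← mul_assoc]
    apply mul_le_mul_of_nonpos_right _ h1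
    rw [← abs_mul]
    exact le_abs_self _

/-- Causal vectors in the fundamental chamber lie in the same cone as `t`. -/
lemma chamber_same [FiniteDimensional ℝ V] (hsymm : ∀ x y : V, B x y = B y x)
    {Δ : Finset V} (hΔ : IsRootBasis B Δ) (hLor : IsLorentz B) {t x : V} (ht : B t t < 0)
    (htC : ∀ α ∈ Δ, 0 ≤ B α t) (hx0 : x ≠ 0) (hx : B x x ≤ 0) (hxC : ∀ α ∈ Δ, 0 ≤ B α x) :
    B t x < 0 := by
  obtain ⟨c, hc, hy⟩ := exists_timelike_in_cone hΔ hLor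
  set y := ∑ α ∈ Δ, c α • α with hydef
  have hnn : ∀ z : V, (∀ α ∈ Δ, 0 ≤ B α z) → 0 ≤ B y z := by
    intro z hz
    simp only [hydef, map_sum, LinearMap.sum_apply, map_smul, LinearMap.smul_apply, smul_eq_mul]
    exact Finset.sum_nonneg fun α hα => mul_nonneg (hc α) (hz α hα)
  have ht0 : t ≠ 0 := by rintro rfl; simp at ht
  have hpos : ∀ z : V, z ≠ 0 → B z z ≤ 0 → (∀ α ∈ Δ, 0 ≤ B α z) → 0 < B y z := by
    intro z hz0 hz hzC
    refine lt_of_le_of_ne (hnn z hzC) fun h => ?_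
    exact absurd (perp_pos hsymm hLor hy h.symm hz0) (not_lt.2 hz)
  have h1 := hpos t ht0 ht.le htC
  have h2 := hpos x hx0 hx hxC
  have := same_sign hsymm hLor (t := y) (u := -t) hy (by simpa using ht) (by simpa using h1) hx0 hx
  simp only [map_neg, LinearMap.neg_apply] at this
  nlinarith

/-- Gordan's theorem: the fundamental chamber has an interior point. -/
lemma exists_interior [FiniteDimensional ℝ V] (hsymm : ∀ x y : V, B x y = B y x)
    {Δ : Finset V} (hΔ : IsRootBasis B Δ) (hLor : IsLorentz B) :
    ∃ z : V, ∀ α ∈ Δ, 0 < B α z := by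
  let e := (Module.finBasis ℝ V).equivFun
  let _ : NormedAddCommGroup V :=
    NormedAddCommGroup.induced V (Fin (Module.finrank ℝ V) → ℝ) e e.injective
  let _ : NormedSpace ℝ V := NormedSpace.induced ℝ V (Fin (Module.finrank ℝ V) → ℝ) e
  have h0 : (0 : V) ∉ convexHull ℝ (Δ : Set V) := by
    intro h
    obtain ⟨w, hw, hw1, hw0⟩ := Finset.mem_convexHull'.1 h
    have := hΔ.posIndep w hw hw0
    rw [Finset.sum_eq_zero this] at hw1
    exact zero_ne_one hw1
  obtain ⟨f, u, hu, hf⟩ := geometric_hahn_banach_point_closed (convex_convexHull ℝ _)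
    (Set.Finite.isClosed_convexHull _ Δ.finite_toSet) h0
  rw [map_zero] at hu
  refine ⟨(B.toDual hLor.1).symm f.toLinearMap, fun α hα => ?_⟩
  rw [hsymm, LinearMap.BilinForm.apply_toDual_symm_apply]
  exact hu.trans (hf α (subset_convexHull ℝ _ hα))

/-- Scaling a facet normal to a weight. -/
lemma scale_weight {Δ I : Finset V} (hΔ : IsRootBasis B Δ)
    (hI : IsFacial Δ I 1) {ω : V} (h0 : ∀ α ∈ I, B α ω = 0)
    (hpos : ∀ α ∈ Δ, α ∉ I → 0 < B α ω) : ∃ c : ℝ, 0 < c ∧ IsWeight B Δ I (c • ω) := by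
  classical
  have hne : (Δ \ I).Nonempty := by
    by_contra h
    rw [Finset.not_nonempty_iff_eq_empty, Finset.sdiff_eq_empty_iff_subset] at h
    have : I = Δ := le_antisymm hI.1 h
    have h1 := hI.2.2
    rw [this, hΔ.spans, finrank_top] at h1
    omega
  obtain ⟨β, hβ, hmin⟩ := Finset.exists_min_image (Δ \ I) (fun α => B α ω) hne
  rw [Finset.mem_sdiff] at hβ
  have hb := hpos β hβ.1 hβ.2
  refine ⟨(B β ω)⁻¹, inv_pos.2 hb, hI, ?_, ?_, ?_, β, hβ.1, hβ.2, ?_⟩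
  · intro α hα
    rw [map_smul, h0 α hα, smul_zero]
  · intro α hα hαI
    rw [map_smul, smul_eq_mul]
    exact mul_pos (inv_pos.2 hb) (hpos α hα hαI)
  · intro α hα hαI
    rw [map_smul, smul_eq_mul, inv_mul_eq_div, one_le_div hb]
    exact hmin α (Finset.mem_sdiff.2 ⟨hα, hαI⟩)
  · rw [map_smul, smul_eq_mul, inv_mul_cancel₀ hb.ne']

lemma cone_convex (I : Finset V) : Convex ℝ (cone I) := by
  rintro x ⟨c, hc, rfl⟩ y ⟨d, hd, rfl⟩ a b ha hb -
  refine ⟨fun α => a * c α + b * d α, fun α hα => ?_, ?_⟩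
  · exact add_nonneg (mul_nonneg ha (hc α hα)) (mul_nonneg hb (hd α hα))
  · simp only [Finset.smul_sum, add_smul, mul_smul, Finset.sum_add_distrib]

/-- The zero set of a chamber vector on `Δ` spans a face. -/
lemma exposed_face {Δ : Finset V} {v : V} (hv : ∀ α ∈ Δ, 0 ≤ B α v)
    {I : Finset V} (hI : I ⊆ Δ) (hmem : ∀ α ∈ Δ, α ∈ I ↔ B α v = 0) :
    IsFace (cone Δ) (cone I) := by
  classical
  have hsub : ∀ x, x ∈ cone I → x ∈ cone Δ ∧ B x v = 0 := by
    rintro x ⟨c, hc, rfl⟩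
    refine ⟨⟨fun α => if α ∈ I then c α else 0, fun α _ => ?_, ?_⟩, ?_⟩
    · dsimp only
      split_ifs with h
      · exact hc α h
      · exact le_rfl
    · simp only [ite_smul, zero_smul, ← Finset.sum_filter]
      congr 1
      ext α
      simp only [Finset.mem_filter]
      exact ⟨fun h => ⟨hI h, h⟩, fun h => h.2⟩
    · simp only [map_sum, LinearMap.sum_apply, map_smul, LinearMap.smul_apply, smul_eq_mul]
      refine Finset.sum_eq_zero fun α hα => ?_
      rw [(hmem α (hI hα)).1 hα, mul_zero]
  have hnn : ∀ x ∈ cone Δ, 0 ≤ B x v := by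
    rintro x ⟨c, hc, rfl⟩
    simp only [map_sum, LinearMap.sum_apply, map_smul, LinearMap.smul_apply, smul_eq_mul]
    exact Finset.sum_nonneg fun α hα => mul_nonneg (hc α hα) (hv α hα)
  have hback : ∀ x ∈ cone Δ, B x v = 0 → x ∈ cone I := by
    rintro x ⟨c, hc, rfl⟩ h
    simp only [map_sum, LinearMap.sum_apply, map_smul, LinearMap.smul_apply, smul_eq_mul] at h
    rw [Finset.sum_eq_zero_iff_of_nonneg fun α hα => mul_nonneg (hc α hα) (hv α hα)] at h
    refine ⟨c, fun α hα => hc α (hI hα), ?_⟩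
    symm
    refine Finset.sum_subset hI fun α hα hαI => ?_
    have : B α v ≠ 0 := fun h' => hαI ((hmem α hα).2 h')
    rw [(mul_eq_zero.1 (h α hα)).resolve_right this, zero_smul]
  refine ⟨fun x hx => (hsub x hx).1, cone_convex I, ?_⟩
  intro x hx y hy s hs0 hs1 hxy
  have h := (hsub _ hxy).2
  simp only [map_add, LinearMap.add_apply, map_smul, LinearMap.smul_apply, smul_eq_mul] at h
  have h1 := hnn x hx
  have h2 := hnn y hy
  have h3 := mul_nonneg hs0.le h1
  have h4 := mul_nonneg (sub_nonneg.2 hs1.le) h2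
  refine ⟨hback x hx ?_, hback y hy ?_⟩
  · have : s * B x v = 0 := by linarith
    exact (mul_eq_zero.1 this).resolve_left hs0.ne'
  · have : (1 - s) * B y v = 0 := by linarith
    exact (mul_eq_zero.1 this).resolve_left (sub_pos.2 hs1).ne'

/-- The chamber is generated by the weights (dual form). -/
lemma exists_weight_pos [FiniteDimensional ℝ V] (hsymm : ∀ x y : V, B x y = B y x)
    {Δ : Finset V} (hΔ : IsRootBasis B Δ) (hLor : IsLorentz B) {u v : V}
    (hv : ∀ α ∈ Δ, 0 ≤ B α v) (huv : 0 < B u v) :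
    ∃ ω ∈ weights B Δ, (∀ α ∈ Δ, 0 ≤ B α ω) ∧ 0 < B u ω := by
  classical
  -- rank of the zero set
  let A : V → Finset V := fun x => Δ.filter fun α => B α x = 0
  let rk : V → ℕ := fun x => Module.finrank ℝ (Submodule.span ℝ (A x : Set V))
  have hrk : ∀ x, rk x ≤ Module.finrank ℝ V := fun x => Submodule.finrank_le _
  have main : ∀ k : ℕ, ∀ v : V, (∀ α ∈ Δ, 0 ≤ B α v) → 0 < B u v →
      Module.finrank ℝ V - rk v = k → ∃ ω ∈ weights B Δ, (∀ α ∈ Δ, 0 ≤ B α ω) ∧ 0 < B u ω := by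
    intro k
    induction k using Nat.strong_induction_on with
    | _ k ih =>
    intro v hv huv hk
    have hperp : ∀ x ∈ Submodule.span ℝ (A v : Set V), B x v = 0 := by
      intro x hx
      have : Submodule.span ℝ (A v : Set V) ≤ LinearMap.ker (B v) := by
        rw [Submodule.span_le]
        intro α hα
        rw [SetLike.mem_coe, LinearMap.mem_ker, hsymm]
        exact (Finset.mem_filter.1 hα).2
      have := this hx
      rw [LinearMap.mem_ker] at this
      rw [hsymm, this]
    have hlt : rk v < Module.finrank ℝ V := by
      refine lt_of_le_of_ne (hrk v) fun h => ?_
      have htop := Submodule.eq_top_of_finrank_eq h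
      have := hperp u (by rw [htop]; trivial)
      linarith
    by_cases hfac : rk v + 1 = Module.finrank ℝ V
    · have hI : A v ⊆ Δ := Finset.filter_subset _ _
      have hmem : ∀ α ∈ Δ, α ∈ A v ↔ B α v = 0 := fun α hα => by simp [A, hα]
      obtain ⟨c, hc, hw⟩ := scale_weight (B := B) hΔ (I := A v) (ω := v)
        ⟨hI, exposed_face hv hI hmem, hfac⟩
        (fun α hα => (hmem α (hI hα)).1 hα)
        (fun α hα hαI => lt_of_le_of_ne (hv α hα) fun h => hαI ((hmem α hα).2 h.symm))
      refine ⟨c • v, ⟨_, hw⟩, fun α hα => ?_, ?_⟩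
      · rw [map_smul]; exact mul_nonneg hc.le (hv α hα)
      · rw [map_smul]; exact mul_pos hc huv
    · -- find a direction orthogonal to `A v` and to `u`
      have hlt2 : Submodule.span ℝ (A v : Set V) ⊔ Submodule.span ℝ {u} < ⊤ := by
        rw [lt_top_iff_ne_top]
        intro h
        have h1 := Submodule.finrank_add_le_finrank_add_finrank
          (Submodule.span ℝ (A v : Set V)) (Submodule.span ℝ {u})
        rw [h, finrank_top] at h1
        have h2 := finrank_span_singleton (K := ℝ) (v := u) (by rintro rfl; simp at huv)
        change _ ≤ rk v + _ at h1
        omega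
      obtain ⟨φ, hφ0, hφ⟩ := Submodule.exists_le_ker_of_lt_top _ hlt2
      obtain ⟨d, hd⟩ : ∃ d : V, ∀ x, B x d = φ x :=
        ⟨(B.toDual hLor.1).symm φ, fun x => by
          rw [hsymm, LinearMap.BilinForm.apply_toDual_symm_apply]⟩
      have hφA : ∀ α ∈ A v, φ α = 0 := fun α hα =>
        hφ (Submodule.mem_sup_left (Submodule.subset_span hα))
      have hφu : φ u = 0 := hφ (Submodule.mem_sup_right (Submodule.mem_span_singleton_self u))
      obtain ⟨α₁, hα₁, hα₁0⟩ : ∃ α ∈ Δ, φ α ≠ 0 := by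
        by_contra hcon
        push Not at hcon
        apply hφ0
        have : Submodule.span ℝ (Δ : Set V) ≤ LinearMap.ker φ := by
          rw [Submodule.span_le]; exact fun α hα => hcon α hα
        rw [hΔ.spans, top_le_iff, LinearMap.ker_eq_top] at this
        exact this
      -- choose the sign of the direction
      obtain ⟨σ, hσ0, hσ⟩ : ∃ σ : ℝ, σ ≠ 0 ∧ σ * φ α₁ < 0 := by
        refine ⟨-φ α₁, neg_ne_zero.2 hα₁0, ?_⟩
        have := mul_self_pos.2 hα₁0
        linarith
      obtain ⟨β, hβ, hmin⟩ := Finset.exists_min_image (Δ.filter fun α => σ * φ α < 0)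
        (fun α => B α v / (-(σ * φ α))) ⟨α₁, Finset.mem_filter.2 ⟨hα₁, hσ⟩⟩
      rw [Finset.mem_filter] at hβ
      obtain ⟨hβ, hβneg⟩ := hβ
      set s := B β v / (-(σ * φ β)) with hs
      have hs0 : 0 ≤ s := div_nonneg (hv β hβ) (by linarith)
      have hval : ∀ x, B x (v + (s * σ) • d) = B x v + s * (σ * φ x) := by
        intro x
        rw [map_add, map_smul, hd, smul_eq_mul]; ring
      have hβ0 : B β (v + (s * σ) • d) = 0 := by
        have hne : σ * φ β ≠ 0 := hβneg.ne
        rw [hval, hs, div_neg, neg_mul, div_mul_cancel₀ _ hne]; ring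
      have hv' : ∀ α ∈ Δ, 0 ≤ B α (v + (s * σ) • d) := by
        intro α hα
        rw [hval]
        by_cases hneg : σ * φ α < 0
        · have h1 := hmin α (Finset.mem_filter.2 ⟨hα, hneg⟩)
          change s ≤ _ at h1
          rw [le_div_iff₀ (by linarith)] at h1
          linarith
        · exact add_nonneg (hv α hα) (mul_nonneg hs0 (not_lt.1 hneg))
      have hu' : 0 < B u (v + (s * σ) • d) := by
        rw [hval, hφu]; simpa using huv
      have hrklt : rk v < rk (v + (s * σ) • d) := by
        apply Submodule.finrank_lt_finrank_of_lt
        refine lt_of_le_of_ne (Submodule.span_mono fun α hα => ?_) fun h => ?_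
        · have h1 := hφA α hα
          rw [Finset.mem_coe, Finset.mem_filter] at hα ⊢
          refine ⟨hα.1, ?_⟩
          rw [hval, hα.2, h1]; ring
        · have h1 : β ∈ Submodule.span ℝ (A v : Set V) := by
            rw [h]
            exact Submodule.subset_span (Finset.mem_coe.2 (Finset.mem_filter.2 ⟨hβ, hβ0⟩))
          have h2 : φ β = 0 := hφ (Submodule.mem_sup_left h1)
          rw [h2, mul_zero] at hβneg
          exact lt_irrefl _ hβneg
      have := hrk (v + (s * σ) • d)
      exact ih _ (by omega) _ hv' hu' rfl
  exact main _ v hv huv rfl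

/-- Elements of the span of `I` are differences of elements of the cone. -/
lemma span_eq_sub {I : Finset V} {x : V} (hx : x ∈ Submodule.span ℝ (I : Set V)) :
    ∃ p ∈ cone I, ∃ q ∈ cone I, x + q = p := by
  obtain ⟨c, -, rfl⟩ := Submodule.mem_span_finset.1 hx
  refine ⟨∑ α ∈ I, |c α| • α, ⟨fun α => |c α|, fun α _ => abs_nonneg _, rfl⟩,
    ∑ α ∈ I, (|c α| - c α) • α, ⟨fun α => |c α| - c α, fun α _ => ?_, rfl⟩, ?_⟩
  · exact sub_nonneg.2 (le_abs_self _)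
  · rw [← Finset.sum_add_distrib]
    refine Finset.sum_congr rfl fun α _ => ?_
    rw [← add_smul]; congr 1; ring

lemma cone_smul {I : Finset V} {x : V} (hx : x ∈ cone I) {a : ℝ} (ha : 0 ≤ a) :
    a • x ∈ cone I := by
  obtain ⟨c, hc, rfl⟩ := hx
  refine ⟨fun α => a * c α, fun α hα => mul_nonneg ha (hc α hα), ?_⟩
  simp only [Finset.smul_sum, mul_smul]

lemma cone_single {I : Finset V} {α : V} (hα : α ∈ I) : α ∈ cone I := by
  classical
  refine ⟨fun β => if β = α then 1 else 0, fun β _ => ?_, ?_⟩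
  · dsimp only
    split_ifs
    · exact zero_le_one
    · exact le_rfl
  · simp [hα]

/-- Faces absorb summands. -/
lemma face_absorb {Δ I : Finset V} (hF : IsFace (cone Δ) (cone I)) {x y : V}
    (hx : x ∈ cone Δ) (hy : y ∈ cone Δ) (hxy : x + y ∈ cone I) : x ∈ cone I := by
  refine (hF.2.2 x hx y hy (1 / 2) (by norm_num) (by norm_num) ?_).1
  have := cone_smul hxy (a := 1 / 2) (by norm_num)
  convert this using 1
  module

lemma cone_add {I : Finset V} {x y : V} (hx : x ∈ cone I) (hy : y ∈ cone I) :
    x + y ∈ cone I := by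
  have := cone_smul (cone_convex I hx hy (a := 1 / 2) (b := 1 / 2) (by norm_num) (by norm_num)
    (by norm_num)) (a := 2) (by norm_num)
  convert this using 1
  module

/-- A facet containing a timelike vector in its span yields a weight. -/
lemma exists_weight_of_facial [FiniteDimensional ℝ V] (hsymm : ∀ x y : V, B x y = B y x)
    {Δ I : Finset V} (hΔ : IsRootBasis B Δ) (hLor : IsLorentz B) (hI : IsFacial Δ I 1) :
    ∃ ω : V, IsWeight B Δ I ω := by
  classical
  have hF := hI.2.1
  have hlt : Submodule.span ℝ (I : Set V) < ⊤ := by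
    rw [lt_top_iff_ne_top]
    intro h
    have := hI.2.2
    rw [h, finrank_top] at this
    omega
  obtain ⟨φ, hφ0, hφ⟩ := Submodule.exists_le_ker_of_lt_top _ hlt
  have hker : LinearMap.ker φ = Submodule.span ℝ (I : Set V) := by
    symm
    apply Submodule.eq_of_le_of_finrank_le hφ
    have h1 := LinearMap.finrank_range_add_finrank_ker φ
    have h2 : LinearMap.range φ = ⊤ := LinearMap.range_eq_top.2 (LinearMap.surjective hφ0)
    rw [h2, finrank_top, Module.finrank_self] at h1
    have := hI.2.2
    omega
  -- elements of the cone of `Δ` that together have `φ = 0` lie in the cone of `I`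
  have habs : ∀ x ∈ cone Δ, ∀ y ∈ cone Δ, φ (x + y) = 0 → x ∈ cone I := by
    intro x hx y hy hxy
    have hmem : x + y ∈ Submodule.span ℝ (I : Set V) := by rw [← hker]; exact hxy
    obtain ⟨p, hp, q, hq, hpq⟩ := span_eq_sub hmem
    refine face_absorb hF hx (cone_add hy (hF.1 hq)) ?_
    rw [← add_assoc, hpq]; exact hp
  have hnot : ∀ α ∈ Δ, α ∉ I → α ∉ cone I := by
    rintro α hα hαI ⟨c, hc, h⟩
    have h1 := hΔ.unit α hα
    have h2 : B α (∑ β ∈ I, c β • β) = ∑ β ∈ I, c β * B α β := by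
      simp only [map_sum, map_smul, smul_eq_mul]
    rw [← h] at h2
    have h3 : ∑ β ∈ I, c β * B α β ≤ 0 := Finset.sum_nonpos fun β hβ =>
      mul_nonpos_of_nonneg_of_nonpos (hc β hβ)
        (offdiag_nonpos hΔ hα (hI.1 hβ) (fun h => hαI (h ▸ hβ)))
    linarith
  have hzero : (0 : V) ∈ cone Δ := ⟨0, by simp, by simp⟩
  have hne : ∀ α ∈ Δ, α ∉ I → φ α ≠ 0 := by
    intro α hα hαI h
    exact hnot α hα hαI (habs α (cone_single hα) 0 hzero (by simpa using h))
  have hsame : ∀ α ∈ Δ, α ∉ I → ∀ β ∈ Δ, β ∉ I → ¬ (0 < φ α ∧ φ β < 0) := by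
    rintro α hα hαI β hβ hβI ⟨h1, h2⟩
    have h3 := habs ((-φ β) • α) (cone_smul (cone_single hα) (by linarith)) (φ α • β)
      (cone_smul (cone_single hβ) h1.le) (by
        rw [map_add, map_smul, map_smul, smul_eq_mul, smul_eq_mul]; ring)
    have h4 := cone_smul h3 (a := (-φ β)⁻¹) (inv_nonneg.2 (by linarith))
    rw [smul_smul, inv_mul_cancel₀ (by linarith), one_smul] at h4
    exact hnot α hα hαI h4
  obtain ⟨d, hd⟩ : ∃ d : V, ∀ x, B x d = φ x :=
    ⟨(B.toDual hLor.1).symm φ, fun x => by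
      rw [hsymm, LinearMap.BilinForm.apply_toDual_symm_apply]⟩
  have hzeroI : ∀ α ∈ I, φ α = 0 := fun α hα => hφ (Submodule.subset_span hα)
  by_cases hpos : ∃ α ∈ Δ, α ∉ I ∧ 0 < φ α
  · obtain ⟨α, hα, hαI, h⟩ := hpos
    obtain ⟨c, -, hw⟩ := scale_weight (ω := d) hΔ hI (fun β hβ => by rw [hd, hzeroI β hβ])
      (fun β hβ hβI => by
        rw [hd]
        by_contra hcon
        exact hsame α hα hαI β hβ hβI ⟨h, lt_of_le_of_ne (not_lt.1 hcon) (hne β hβ hβI)⟩)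
    exact ⟨_, hw⟩
  · push Not at hpos
    obtain ⟨c, -, hw⟩ := scale_weight (ω := -d) hΔ hI
      (fun β hβ => by rw [map_neg, hd, hzeroI β hβ, neg_zero])
      (fun β hβ hβI => by
        rw [map_neg, hd, neg_pos]
        exact lt_of_le_of_ne (hpos β hβ hβI) (hne β hβ hβI))
    exact ⟨_, hw⟩

/-- A closed set of vectors of fixed norm on which `B · t` is bounded above has a maximizer. -/
lemma exists_max [FiniteDimensional ℝ V] (hsymm : ∀ x y : V, B x y = B y x) (hLor : IsLorentz B)
    {t : V} (ht : B t t < 0) (X : Set V) (c M : ℝ) {v₀ : V} (hv₀ : B v₀ v₀ = c)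
    (hX₀ : ∀ y ∈ X, B v₀ y ≤ 0)
    (hM : ∀ x : V, B x x = c → (∀ y ∈ X, B x y ≤ 0) → 0 ≤ B x t → (B x t) ^ 2 ≤ M) :
    ∃ x : V, B x x = c ∧ (∀ y ∈ X, B x y ≤ 0) ∧
      ∀ z : V, B z z = c → (∀ y ∈ X, B z y ≤ 0) → B z t ≤ B x t := by
  set T := B t t with hT
  have hTne : T ≠ 0 := ht.ne
  have hpos : ∀ x : V, x ≠ 0 → 0 < B x x - 2 * (B x t * B x t) / T := by
    intro x hx
    set m := B t x with hm
    have hm' : B x t = m := hsymm _ _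
    rw [hm']
    by_cases h0 : m = 0
    · rw [h0]
      simpa using perp_pos hsymm hLor ht h0 hx
    · have h1 : 0 ≤ B x x - m ^ 2 / T := by
        have := perp_nonneg hsymm hLor ht (x := (1 : ℝ) • x + (-(m / T)) • t) (by
          rw [expand_right, ← hm, ← hT]; field_simp; ring)
        rw [expand, hm', ← hm, ← hT] at this
        convert this using 1
        field_simp
        ring
      have h2 : m ^ 2 / T < 0 := div_neg_of_pos_of_neg (by positivity) ht
      have h3 : 2 * (m * m) / T = m ^ 2 / T + m ^ 2 / T := by ring
      rw [h3]
      linarith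
  let core : InnerProductSpace.Core ℝ V :=
    { inner := fun x y => B x y - 2 * (B x t * B y t) / T
      conj_inner_symm := fun x y => by
        simp only [conj_trivial]
        rw [hsymm y x]; ring
      re_inner_nonneg := fun x => by
        by_cases hx : x = 0
        · simp [hx]
        · exact (hpos x hx).le
      add_left := fun x y z => by
        simp only [map_add, LinearMap.add_apply]; ring
      smul_left := fun x y r => by
        simp only [map_smul, LinearMap.smul_apply, smul_eq_mul, conj_trivial]; ring
      definite := fun x hx => by
        by_contra h
        exact (hpos x h).ne' hx }
  let _ : NormedAddCommGroup V := core.toNormedAddCommGroup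
  let _ : InnerProductSpace ℝ V := InnerProductSpace.ofCore core.toCore
  have hnorm : ∀ x : V, ‖x‖ ^ 2 = B x x - 2 * (B x t * B x t) / T := fun x =>
    (real_inner_self_eq_norm_sq x).symm
  have hcont : ∀ φ : V →ₗ[ℝ] ℝ, Continuous φ := fun φ => φ.continuous_of_finiteDimensional
  have hcl : ∀ y : V, Continuous fun x => B x y := by
    intro y
    have : (fun x => B x y) = fun x => B y x := funext fun x => hsymm _ _
    rw [this]
    exact hcont _
  have hq : Continuous fun x => B x x := by
    have : (fun x => B x x) = fun x => ‖x‖ ^ 2 + 2 * (B x t * B x t) / T := by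
      funext x
      rw [hnorm]; ring
    rw [this]
    have := hcl t
    fun_prop
  let K : Set V := {x | B x x = c ∧ (∀ y ∈ X, B x y ≤ 0) ∧ B v₀ t ≤ B x t}
  have hKc : IsClosed K := by
    apply IsClosed.and (isClosed_eq hq continuous_const)
    apply IsClosed.and
    · have : {x | ∀ y ∈ X, B x y ≤ 0} = ⋂ y ∈ X, {x | B x y ≤ 0} := by ext; simp
      change IsClosed {x | ∀ y ∈ X, B x y ≤ 0}
      rw [this]
      exact isClosed_biInter fun y _ => isClosed_le (hcl y) continuous_const
    · exact isClosed_le continuous_const (hcl t)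
  have hKb : Bornology.IsBounded K := by
    rw [isBounded_iff_forall_norm_le]
    refine ⟨Real.sqrt (c + 2 * (|M| + (B v₀ t) ^ 2) / (-T)), fun x hx => ?_⟩
    obtain ⟨hx1, hx2, hx3⟩ := hx
    apply Real.le_sqrt_of_sq_le
    rw [hnorm, hx1]
    have h1 : B x t * B x t ≤ |M| + (B v₀ t) ^ 2 := by
      rcases le_total 0 (B x t) with h | h
      · have := hM x hx1 hx2 h
        nlinarith [le_abs_self M, sq_nonneg (B v₀ t)]
      · nlinarith [abs_nonneg M]
    have h2 : 2 * (B x t * B x t) / (-T) ≤ 2 * (|M| + (B v₀ t) ^ 2) / (-T) := by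
      apply div_le_div_of_nonneg_right _ (by linarith)
      linarith
    rw [div_neg] at h2
    linarith
  have hK : IsCompact K := Metric.isCompact_of_isClosed_isBounded hKc hKb
  obtain ⟨x, hx, hmax⟩ := hK.exists_isMaxOn ⟨v₀, hv₀, hX₀, le_rfl⟩ (hcl t).continuousOn
  refine ⟨x, hx.1, hx.2.1, fun z hz1 hz2 => ?_⟩
  by_contra hcon
  push Not at hcon
  exact absurd (hmax (show z ∈ K from ⟨hz1, hz2, hx.2.2.trans hcon.le⟩)) (not_le.2 hcon)

/-- A facet of non-finite, non-affine type gives a spacelike weight together with a timelike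
vector that is a sum of two lightlike vectors interior to the ball of the weight. -/
lemma exists_spacelike_weight [FiniteDimensional ℝ V] (hsymm : ∀ x y : V, B x y = B y x)
    {Δ : Finset V} (hΔ : IsRootBasis B Δ) (hLor : IsLorentz B) (h1 : ¬ LevelLE B Δ 1)
    {t : V} (ht : B t t < 0) :
    ∃ ω ∈ weights B Δ, 0 < B ω ω ∧ ∃ u e : V, B u u < 0 ∧ B t u < 0 ∧
      B (u + e) (u + e) = 0 ∧ B (u - e) (u - e) = 0 ∧
      B u (u + e) < 0 ∧ B u (u - e) < 0 ∧ 0 < B ω (u + e) ∧ 0 < B ω (u - e) := by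
  unfold LevelLE at h1
  push Not at h1
  obtain ⟨I, hI, y₁, hyI₁, hy₁⟩ := h1
  obtain ⟨y, hyI, hy, hty⟩ : ∃ y ∈ Submodule.span ℝ (I : Set V), B y y < 0 ∧ B t y < 0 := by
    have hy0 : y₁ ≠ 0 := by
      rintro rfl
      simp at hy₁
    rcases lt_trichotomy (B t y₁) 0 with h | h | h
    · exact ⟨y₁, hyI₁, hy₁, h⟩
    · exact absurd (perp_pos hsymm hLor ht h hy0) (not_lt.2 hy₁.le)
    · exact ⟨-y₁, Submodule.neg_mem _ hyI₁, by simpa using hy₁, by simpa using h⟩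
  obtain ⟨ω, hω⟩ := exists_weight_of_facial hsymm hΔ hLor hI
  have hperp : ∀ x ∈ Submodule.span ℝ (I : Set V), B ω x = 0 := by
    intro x hx
    have : Submodule.span ℝ (I : Set V) ≤ LinearMap.ker (B ω) := by
      rw [Submodule.span_le]
      intro α hα
      rw [SetLike.mem_coe, LinearMap.mem_ker, hsymm]
      exact hω.2.1 α hα
    exact this hx
  have hωy := hperp y hyI
  have hω0 : ω ≠ 0 := by
    rintro rfl
    obtain ⟨α, _, _, h⟩ := hω.2.2.2.2
    simp at h
  have hωω : 0 < B ω ω := perp_pos hsymm hLor hy (by rw [hsymm]; exact hωy) hω0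
  refine ⟨ω, ⟨I, hω⟩, hωω, ?_⟩
  obtain ⟨α, hα⟩ : I.Nonempty := by
    rw [Finset.nonempty_iff_ne_empty]
    rintro rfl
    simp only [Finset.coe_empty, Submodule.span_empty, Submodule.mem_bot] at hyI
    rw [hyI] at hy
    simp at hy
  have hωα := hperp α (Submodule.subset_span hα)
  have hαα := hΔ.unit α (hI.1 hα)
  set m := B α y with hm
  set Y := B y y with hY
  have hYne : Y ≠ 0 := hy.ne
  set d : V := (1 : ℝ) • α + (-(m / Y)) • y with hd
  have hyd : B y d = 0 := by
    rw [hd, expand_right, hsymm y α, ← hm, ← hY]; field_simp; ring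
  have hωd : B ω d = 0 := by
    rw [hd, expand_right, hωα, hωy]; ring
  have hdd : 0 < B d d := by
    have e1 : B d d = 1 - m ^ 2 / Y := by
      rw [hd, expand, hsymm y α, ← hm, ← hY, hαα]; field_simp; ring
    have : m ^ 2 / Y ≤ 0 := div_nonpos_of_nonneg_of_nonpos (sq_nonneg _) hy.le
    linarith
  obtain ⟨ε, hε, hεY⟩ := exists_small Y 0 (B ω ω) hy
  set u : V := (1 : ℝ) • y + ε • ω with hu
  have huu : B u u = Y + ε ^ 2 * B ω ω := by
    rw [hu, expand, hωy, hsymm y ω, hωy]; ring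
  have huneg : B u u < 0 := by rw [huu]; linarith
  have hyu : B y u < 0 := by
    rw [hu, expand_right, hsymm y ω, hωy, ← hY]; linarith
  have hu0 : u ≠ 0 := by
    intro h
    rw [h] at hyu
    simp at hyu
  have htu : B t u < 0 := by
    have := same_sign hsymm hLor ht hy hty hu0 huneg.le
    nlinarith
  have hud : B u d = 0 := by
    rw [hsymm, hu, expand_right, hsymm d y, hsymm d ω, hyd, hωd]; ring
  have hωu : B ω u = ε * B ω ω := by
    rw [hu, expand_right, hωy]; ring
  set r := Real.sqrt (-(B u u) / B d d) with hr
  have hr2 : r ^ 2 * B d d = -(B u u) := by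
    rw [hr, Real.sq_sqrt (div_nonneg (by linarith) hdd.le), div_mul_cancel₀ _ hdd.ne']
  refine ⟨u, r • d, huneg, htu, ?_, ?_, ?_, ?_, ?_, ?_⟩ <;>
  simp only [map_add, map_sub, map_smul, LinearMap.add_apply, LinearMap.sub_apply,
    LinearMap.smul_apply, smul_eq_mul, hud, hsymm d u, hωd, hωu]
  · nlinarith
  · nlinarith
  · linarith
  · linarith
  · have := mul_pos hε hωω
    linarith
  · have := mul_pos hε hωω
    linarith

/-- No ball can be added to the packing. -/
lemma no_disjoint_ball [FiniteDimensional ℝ V] (hsymm : ∀ x y : V, B x y = B y x)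
    {Δ : Finset V} (hΔ : IsRootBasis B Δ) (hLor : IsLorentz B) (h1 : ¬ LevelLE B Δ 1)
    {t : V} (ht : B t t < 0) (htC : ∀ α ∈ Δ, 0 ≤ B α t) {v : V} (hv : 0 < B v v)
    (hdisj : ∀ ω ∈ Omega B Δ, 0 < B ω ω → ∀ x : V, x ≠ 0 → B x x = 0 → B t x < 0 →
      0 < B ω x → B v x ≤ 0) : False := by
  have ht0 : t ≠ 0 := by rintro rfl; simp at ht
  -- an interior timelike vector
  obtain ⟨z, hz⟩ := exists_interior hsymm hΔ hLor
  obtain ⟨ε, hε, hεt⟩ := exists_small (B t t) (2 * B t z) (B z z) ht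
  set s : V := (1 : ℝ) • t + ε • z with hs
  have hss : B s s < 0 := by
    rw [hs, expand, hsymm z t]
    nlinarith
  have hsC : ∀ α ∈ Δ, 0 < B α s := by
    intro α hα
    rw [hs, expand_right]
    have := mul_pos hε (hz α hα)
    have := htC α hα
    linarith
  have hs0 : s ≠ 0 := by rintro h; rw [h] at hss; simp at hss
  have hts : B t s < 0 := chamber_same hsymm hΔ hLor ht htC hs0 hss.le fun α hα => (hsC α hα).le
  -- the set of light vectors covered by the packing
  let X : Set V := {x | x ≠ 0 ∧ B x x = 0 ∧ B t x < 0 ∧ ∃ ω ∈ Omega B Δ, 0 < B ω ω ∧ 0 < B ω x}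
  have hXv : ∀ y ∈ X, B v y ≤ 0 := fun y ⟨h0, hl, hty, ω, hω, hωω, hωy⟩ =>
    hdisj ω hω hωω y h0 hl hty hωy
  have hXrefl : ∀ α ∈ Δ, ∀ y ∈ X, reflection B α y ∈ X := by
    rintro α hα y ⟨h0, hl, hty, ω, hω, hωω, hωy⟩
    have hα1 := hΔ.unit α hα
    refine ⟨fun h => h0 ?_, ?_, ?_, reflection B α ω, Omega_refl hΔ hα hω, ?_, ?_⟩
    · rw [← refl_refl hα1 y, h, map_zero]
    · rw [refl_isom hsymm hα1, hl]
    · rw [← refl_adj hsymm hα1]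
      have h2 : B t (reflection B α t) < 0 := by
        rw [refl_apply, map_sub, map_smul, smul_eq_mul, hsymm t α]
        nlinarith [mul_self_nonneg (B α t)]
      have := same_sign hsymm hLor ht (u := reflection B α t)
        (by rw [refl_isom hsymm hα1]; exact ht) h2 h0 hl.le
      nlinarith
    · rw [refl_isom hsymm hα1]; exact hωω
    · rw [refl_isom hsymm hα1]; exact hωy
  -- upper bound
  obtain ⟨ω₀, hω₀, hω₀pos, u, e, hu, htu, hl1, hl2, hn1, hn2, hp1, hp2⟩ :=
    exists_spacelike_weight hsymm hΔ hLor h1 ht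
  have hXmem : ∀ x : V, B x x = 0 → B u x < 0 → 0 < B ω₀ x → x ∈ X := by
    intro x hx hux hωx
    have hx0 : x ≠ 0 := by
      rintro rfl
      simp at hux
    have := same_sign hsymm hLor ht hu htu hx0 hx.le
    exact ⟨hx0, hx, by nlinarith, ω₀, weights_sub_Omega hω₀, hω₀pos, hωx⟩
  have hm1 := hXmem _ hl1 hn1 hp1
  have hm2 := hXmem _ hl2 hn2 hp2
  have hu0 : u ≠ 0 := by
    rintro rfl
    simp at hu
  have hsu : B s u < 0 := by
    have := same_sign hsymm hLor ht hss hts hu0 hu.le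
    nlinarith
  obtain ⟨M, hM⟩ := bound_above hsymm hLor hss hu hsu (B v v)
  obtain ⟨x, hxx, hxX, hmax⟩ := exists_max hsymm hLor hss X (B v v) M rfl hXv (by
    intro x hx hxX hxs
    refine hM x hx ?_ hxs
    have e1 := hxX _ hm1
    have e2 := hxX _ hm2
    rw [map_add] at e1
    rw [map_sub] at e2
    linarith)
  -- the maximizer lies in the chamber
  have hxC : ∀ α ∈ Δ, 0 ≤ B α x := by
    intro α hα
    have hα1 := hΔ.unit α hα
    have h2 := hmax (reflection B α x) (by rw [refl_isom hsymm hα1, hxx]) (fun y hy => by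
      rw [refl_adj hsymm hα1]
      exact hxX _ (hXrefl α hα y hy))
    rw [refl_apply, map_sub, map_smul, LinearMap.sub_apply, LinearMap.smul_apply,
      smul_eq_mul] at h2
    have h3 : 0 ≤ B α x * B α s := by linarith
    exact nonneg_of_mul_nonneg_left h3 (hsC α hα)
  -- a light vector in the interior of its ball
  obtain ⟨p, hp0, hpp, htp, hxp⟩ := exists_light hsymm ht (v := x) (by rw [hxx]; exact hv)
  obtain ⟨ω, hω, hωC, hpω⟩ := exists_weight_pos hsymm hΔ hLor hxC (u := p)
    (by rw [hsymm]; exact hxp)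
  have hω0 : ω ≠ 0 := by
    rintro rfl
    simp at hpω
  have hωω : 0 < B ω ω := by
    by_contra hcon
    push Not at hcon
    have h3 := chamber_same hsymm hΔ hLor ht htC hω0 hcon hωC
    exact absurd (causal_pair hsymm hLor ht hpp.le hcon htp h3) (not_le.2 hpω)
  have := hxX p ⟨hp0, hpp, htp, ω, weights_sub_Omega hω, hωω, by rw [hsymm]; exact hpω⟩
  linarith

end Helpers

/-- extending Maxwell, Theorem 3.3. The Boyd–Maxwell ball
packing of a Lorentzian based root system of level `2` is maximal: any ball
whose interior avoids the interiors of all balls of the packing is already a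
ball of the packing. -/
theorem packing_maximal
    {V : Type*} [AddCommGroup V] [Module ℝ V] [FiniteDimensional ℝ V]
    (B : LinearMap.BilinForm ℝ V) (hsymm : ∀ x y : V, B x y = B y x)
    (Δ : Finset V) (hΔ : IsRootBasis B Δ) (hLor : IsLorentz B)
    (h2 : HasLevel B Δ 2)
    (t : V) (ht : B t t < 0) (htC : t ∈ chamber B Δ)
    (v : V) (hv : 0 < B v v)
    (hdisj : ∀ ω ∈ Omega B Δ, 0 < B ω ω →
      Disjoint (ballIntVec B t v) (ballIntVec B t ω)) :
    ∃ ω ∈ Omega B Δ, 0 < B ω ω ∧ ballVec B t v = ballVec B t ω := by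
  exfalso
  refine no_disjoint_ball hsymm hΔ hLor (h2.2 1 (by norm_num)) ht
    (fun α hα => by rw [hsymm]; exact htC α hα) hv ?_
  intro ω hω hωω x hx0 hxx htx hωx
  by_contra hcon
  push Not at hcon
  exact Set.disjoint_left.1 (hdisj ω hω hωω)
    (show x ∈ ballIntVec B t v from ⟨hx0, hxx, mul_neg_of_pos_of_neg hcon htx⟩)
    (show x ∈ ballIntVec B t ω from ⟨hx0, hxx, mul_neg_of_pos_of_neg hωx htx⟩)

end BoydMaxwell
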